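/- Let d ≥ 1, N ∈ ℕ, and σ = (σ_1,…,σ_{d+1}) ∈ ℝ^{d+1} satisfying either σ_i > −1 for all i = 1,…,d+1, or σ_i < −N for all i = 1,…,d+1 with no σ_i an integer. For ν ∈ ℕ_0^d with |ν| ≤ N define Q_ν(x; σ, N) = [(−1)^{|ν|}/(−N)_{|ν|}] · Π_{j=1}^d [(σ_j+1)_{ν_j}/(a_j+1)_{ν_j}] · (−N + |X_{j−1}| + |ν^{j+1}|)_{ν_j} Q_{ν_j}(x_j; σ_j, a_j, N − |X_{j−1}| − |ν^{j+1}|), where a_j = |σ^{j+1}| + 2|ν^{j+1}| + d − j. Then for all ν, μ ∈ ℕ_0^d with |ν| ≤ N and |μ| ≤ N, Σ_{x ∈ ℕ_0^d, |x| ≤ N} Q_ν(x;σ,N) Q_μ(x;σ,N) Π_{i=1}^d C(x_i+σ_i, x_i) · C(N−|x|+σ_{d+1}, N−|x|) = A_ν δ_{ν,μ}, where A_ν = [(−1)^{|ν|} (|σ|+d+2|ν|+1)_{N−|ν|} / ((−N)_{|ν|} N!)] · Π_{j=1}^d [(σ_j+a_j+ν_j+1)_{ν_j} (σ_j+1)_{ν_j}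 ν_j! / (a_j+1)_{ν_j}]. -/

import Mathlib

open Finset

/-- Pochhammer symbol `(a)_k = a(a+1)⋯(a+k−1)`. -/
noncomputable def poch (a : ℝ) (k : ℕ) : ℝ := ∏ i ∈ Finset.range k, (a + i)

/-- Generalized binomial coefficient `C(a, k) = (a−k+1)_k / k!`. -/
noncomputable def genBinom (a : ℝ) (k : ℕ) : ℝ :=
  poch (a - k + 1) k / (Nat.factorial k : ℝ)

/-- Tail sum over 0-based indices `i ≥ t`. -/
noncomputable def tailFrom (d : ℕ) (y : Fin d → ℝ) (t : ℕ) : ℝ :=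
  ∑ i, if t ≤ i.val then y i else 0

/-- Head sum over 0-based indices `i < j`. -/
noncomputable def headTo (d : ℕ) (y : Fin d → ℝ) (j : Fin d) : ℝ :=
  ∑ i, if i.val < j.val then y i else 0

/-- `(−M)_n Q_n(x; a, b, M)` where `Q_n` is the Hahn polynomial, interpreted
via the cancellation `(−M)_n/(−M)_k = (−M+k)_{n−k}`:
`Σ_{k=0}^n (−n)_k (n+a+b+1)_k (−x)_k (−M+k)_{n−k} / ((a+1)_k k!)`. -/
noncomputable def hahnQM (n : ℕ) (x a b M : ℝ) : ℝ :=
  ∑ k ∈ Finset.range (n + 1),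
    poch (-(n : ℝ)) k * poch ((n : ℝ) + a + b + 1) k * poch (-x) k
      * poch (-M + (k : ℝ)) (n - k)
      / (poch (a + 1) k * (Nat.factorial k : ℝ))

/-- `a_j = |σ^{j+1}| + 2|ν^{j+1}| + d − j` (0-based `j`). -/
noncomputable def aHahn (d : ℕ) (σ : Fin (d + 1) → ℝ) (ν : Fin d → ℕ)
    (j : Fin d) : ℝ :=
  tailFrom (d + 1) σ (j.val + 1) + 2 * tailFrom d (fun i => (ν i : ℝ)) (j.val + 1)
    + ((d : ℝ) - j.val - 1)

/-- The Hahn polynomials `Q_ν(x; σ, N)` of several variables, (5.30). -/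
noncomputable def hahnNu (d : ℕ) (σ : Fin (d + 1) → ℝ) (N : ℕ)
    (ν x : Fin d → ℕ) : ℝ :=
  (-1 : ℝ) ^ (∑ i, ν i) / poch (-(N : ℝ)) (∑ i, ν i)
    * ∏ j, (poch (σ j.castSucc + 1) (ν j) / poch (aHahn d σ ν j + 1) (ν j))
      * hahnQM (ν j) (x j : ℝ) (σ j.castSucc) (aHahn d σ ν j)
          ((N : ℝ) - headTo d (fun i => (x i : ℝ)) j
            - tailFrom d (fun i => (ν i : ℝ)) (j.val + 1))

/-- The weight (5.29):
`W(x) = Π_i C(x_i+σ_i, x_i) · C(N−|x|+σ_{d+1}, N−|x|)`. -/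
noncomputable def Whahn (d : ℕ) (σ : Fin (d + 1) → ℝ) (N : ℕ)
    (x : Fin d → ℕ) : ℝ :=
  (∏ i, genBinom ((x i : ℝ) + σ i.castSucc) (x i))
    * genBinom ((N : ℝ) - ((∑ i, x i : ℕ) : ℝ) + σ (Fin.last d)) (N - ∑ i, x i)

/-- The norm `A_ν` of (5.32). -/
noncomputable def AnuHahn (d : ℕ) (σ : Fin (d + 1) → ℝ) (N : ℕ)
    (ν : Fin d → ℕ) : ℝ :=
  (-1 : ℝ) ^ (∑ i, ν i)
      * poch ((∑ i, σ i) + d + 2 * ((∑ i, ν i : ℕ) : ℝ) + 1) (N - ∑ i, ν i)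
      / (poch (-(N : ℝ)) (∑ i, ν i) * (Nat.factorial N : ℝ))
    * ∏ j, poch (σ j.castSucc + aHahn d σ ν j + (ν j : ℝ) + 1) (ν j)
        * poch (σ j.castSucc + 1) (ν j) * (Nat.factorial (ν j) : ℝ)
        / poch (aHahn d σ ν j + 1) (ν j)

open Polynomial in
/-- The Pochhammer symbol as a polynomial in its argument, shifted by a constant. -/
noncomputable def pochPoly (c : ℝ) (k : ℕ) : ℝ[X] := ∏ i ∈ Finset.range k, (X + C (c + i))

lemma eval_pochPoly (c y : ℝ) (k : ℕ) : (pochPoly c k).eval y = poch (y + c) k := by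
  simp [pochPoly, poch, Polynomial.eval_prod, add_assoc]

lemma natDegree_pochPoly_le (c : ℝ) (k : ℕ) : (pochPoly c k).natDegree ≤ k := by
  refine (Polynomial.natDegree_prod_le _ _).trans ?_
  simp [-map_add, -map_natCast]

@[simp] lemma poch_zero (a : ℝ) : poch a 0 = 1 := by simp [poch]

lemma poch_succ (a : ℝ) (k : ℕ) : poch a (k + 1) = poch a k * (a + k) := by
  simp [poch, Finset.prod_range_succ]

lemma poch_succ' (a : ℝ) (k : ℕ) : poch a (k + 1) = a * poch (a + 1) k := by
  simp only [poch, Finset.prod_range_succ', Nat.cast_add, Nat.cast_one, Nat.cast_zero, add_zero]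
  rw [mul_comm]
  congr 1
  exact Finset.prod_congr rfl fun i _ => by ring

lemma poch_add (a : ℝ) (m n : ℕ) : poch a (m + n) = poch a m * poch (a + m) n := by
  simp only [poch, Finset.prod_range_add, Nat.cast_add, add_assoc]

lemma poch_neg_natCast (m k : ℕ) : poch (-(m : ℝ)) k = (-1) ^ k * (m.descFactorial k : ℝ) := by
  induction k with
  | zero => simp
  | succ k ih =>
    rw [poch_succ, ih, Nat.descFactorial_succ]
    rcases le_or_gt k m with h | h
    · push_cast [Nat.cast_sub h]; ring
    · rw [Nat.descFactorial_of_lt h]; simp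

lemma poch_one_add_natCast (m k : ℕ) :
    poch ((m : ℝ) + 1) k * (m.factorial : ℝ) = ((m + k).factorial : ℝ) := by
  induction k with
  | zero => simp
  | succ k ih =>
    rw [poch_succ, mul_right_comm, ih, ← add_assoc, Nat.factorial_succ]
    push_cast; ring

/-- `(a)_k / k!`. -/
noncomputable def pochDiv (a : ℝ) (k : ℕ) : ℝ := poch a k / (k.factorial : ℝ)

lemma succ_mul_pochDiv_succ (a : ℝ) (k : ℕ) :
    ((k : ℝ) + 1) * pochDiv a (k + 1) = (a + k) * pochDiv a k := by
  have h : (k.factorial : ℝ) ≠ 0 := by positivity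
  rw [pochDiv, pochDiv, poch_succ, Nat.factorial_succ]
  push_cast
  field_simp

lemma succ_mul_pochDiv_succ' (a : ℝ) (k : ℕ) :
    ((k : ℝ) + 1) * pochDiv a (k + 1) = a * pochDiv (a + 1) k := by
  have h : (k.factorial : ℝ) ≠ 0 := by positivity
  rw [pochDiv, pochDiv, poch_succ', Nat.factorial_succ]
  push_cast
  field_simp

/-- The Chu–Vandermonde identity for Pochhammer symbols. -/
lemma sum_antidiagonal_pochDiv (u v : ℝ) (M : ℕ) :
    ∑ p ∈ antidiagonal M, pochDiv u p.1 * pochDiv v p.2 = pochDiv (u + v) M := by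
  induction M with
  | zero => simp [pochDiv]
  | succ M ih =>
    have hM : ((M : ℝ) + 1) ≠ 0 := by positivity
    apply mul_left_cancel₀ hM
    rw [succ_mul_pochDiv_succ, ← ih]
    have h1 : ∑ p ∈ antidiagonal (M + 1), (p.1 : ℝ) * (pochDiv u p.1 * pochDiv v p.2)
        = ∑ p ∈ antidiagonal M, (u + p.1) * (pochDiv u p.1 * pochDiv v p.2) := by
      rw [Finset.Nat.sum_antidiagonal_succ]
      simp only [Nat.cast_zero, zero_mul, zero_add, Nat.cast_add, Nat.cast_one]
      exact Finset.sum_congr rfl fun p _ => by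
        rw [← mul_assoc, succ_mul_pochDiv_succ, mul_assoc]
    have h2 : ∑ p ∈ antidiagonal (M + 1), (p.2 : ℝ) * (pochDiv u p.1 * pochDiv v p.2)
        = ∑ p ∈ antidiagonal M, (v + p.2) * (pochDiv u p.1 * pochDiv v p.2) := by
      rw [Finset.Nat.sum_antidiagonal_succ']
      simp only [Nat.cast_zero, zero_mul, zero_add, Nat.cast_add, Nat.cast_one]
      exact Finset.sum_congr rfl fun p _ => by
        rw [mul_left_comm, succ_mul_pochDiv_succ]; ring
    calc ((M : ℝ) + 1) * ∑ p ∈ antidiagonal (M + 1), pochDiv u p.1 * pochDiv v p.2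
        = ∑ p ∈ antidiagonal (M + 1), (p.1 : ℝ) * (pochDiv u p.1 * pochDiv v p.2)
          + ∑ p ∈ antidiagonal (M + 1), (p.2 : ℝ) * (pochDiv u p.1 * pochDiv v p.2) := by
          rw [← Finset.sum_add_distrib, Finset.mul_sum]
          refine Finset.sum_congr rfl fun p hp => ?_
          have : (p.1 : ℝ) + p.2 = M + 1 := by exact_mod_cast mem_antidiagonal.1 hp
          rw [← this]; ring
      _ = _ := by
          rw [h1, h2, ← Finset.sum_add_distrib, Finset.mul_sum]
          refine Finset.sum_congr rfl fun p hp => ?_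
          have : (p.1 : ℝ) + p.2 = M := by exact_mod_cast mem_antidiagonal.1 hp
          rw [← this]; ring

/-- Factorial moments of the Hahn weight. -/
lemma sum_antidiagonal_poch_mul_poch (k j : ℕ) (u v : ℝ) (M : ℕ) :
    ∑ p ∈ antidiagonal M, poch (-(p.1 : ℝ)) k * poch (-(p.2 : ℝ)) j
        * (pochDiv u p.1 * pochDiv v p.2)
      = if k + j ≤ M then
          (-1) ^ (k + j) * poch u k * poch v j * pochDiv (u + v + k + j) (M - (k + j))
        else 0 := by
  induction k generalizing u M with
  | zero =>
    induction j generalizing v M with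
    | zero => simp [sum_antidiagonal_pochDiv]
    | succ j ih =>
      cases M with
      | zero => simp [poch_succ']
      | succ M =>
        rw [Finset.Nat.sum_antidiagonal_succ']
        have h : ∀ p : ℕ × ℕ, poch (-((p.1 : ℕ) : ℝ)) 0 * poch (-((p.2 + 1 : ℕ) : ℝ)) (j + 1)
            * (pochDiv u p.1 * pochDiv v (p.2 + 1))
            = -v * (poch (-(p.1 : ℝ)) 0 * poch (-(p.2 : ℝ)) j
              * (pochDiv u p.1 * pochDiv (v + 1) p.2)) := fun p => by
          rw [poch_succ', show -((p.2 + 1 : ℕ) : ℝ) + 1 = -(p.2 : ℝ) by push_cast; ring]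
          have := succ_mul_pochDiv_succ' v p.2
          push_cast
          linear_combination (-poch (-(p.1 : ℝ)) 0 * poch (-(p.2 : ℝ)) j * pochDiv u p.1) * this
        simp only [h, ← Finset.mul_sum, ih]
        by_cases hj : 0 + j ≤ M
        · rw [if_pos hj, if_pos (by omega), show M + 1 - (0 + (j + 1)) = M - (0 + j) by omega,
            poch_succ' v]
          simp only [Nat.cast_zero, neg_zero, poch_succ' 0, zero_mul, mul_zero, zero_add]
          rw [show u + v + (0 : ℝ) + ((j + 1 : ℕ) : ℝ) = u + (v + 1) + 0 + j by push_cast; ring]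
          ring
        · rw [if_neg hj, if_neg (by omega)]
          simp [poch_succ' 0]
  | succ k ih =>
    cases M with
    | zero => simp [poch_succ']
    | succ M =>
      rw [Finset.Nat.sum_antidiagonal_succ]
      have h : ∀ p : ℕ × ℕ, poch (-((p.1 + 1 : ℕ) : ℝ)) (k + 1) * poch (-((p.2 : ℕ) : ℝ)) j
          * (pochDiv u (p.1 + 1) * pochDiv v p.2)
          = -u * (poch (-(p.1 : ℝ)) k * poch (-(p.2 : ℝ)) j
            * (pochDiv (u + 1) p.1 * pochDiv v p.2)) := fun p => by
        rw [poch_succ', show -((p.1 + 1 : ℕ) : ℝ) + 1 = -(p.1 : ℝ) by push_cast; ring]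
        have := succ_mul_pochDiv_succ' u p.1
        push_cast
        linear_combination (-poch (-(p.1 : ℝ)) k * poch (-(p.2 : ℝ)) j * pochDiv v p.2) * this
      simp only [h, ← Finset.mul_sum, ih]
      by_cases hj : k + j ≤ M
      · rw [if_pos hj, if_pos (by omega), show M + 1 - (k + 1 + j) = M - (k + j) by omega,
          poch_succ' u]
        simp only [Nat.cast_zero, neg_zero, poch_succ' 0, zero_mul, zero_add]
        rw [show u + v + ((k + 1 : ℕ) : ℝ) + j = u + 1 + v + k + j by push_cast; ring]
        ring
      · rw [if_neg hj, if_neg (by omega)]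
        simp [poch_succ' 0]

/-- Alternating binomial sums annihilate polynomials of degree less than `n`. -/
lemma sum_alternating_choose_eval_eq_zero {n : ℕ} (P : Polynomial ℝ) (hP : P.natDegree < n) :
    ∑ k ∈ Finset.range (n + 1), (-1 : ℝ) ^ k * (n.choose k : ℝ) * P.eval (k : ℝ) = 0 := by
  have h := fwdDiff_iter_eq_sum_shift (1 : ℝ) P.eval n 0
  rw [Polynomial.fwdDiff_iter_eq_zero_of_degree_lt hP] at h
  have h2 : ∑ k ∈ Finset.range (n + 1), (-1 : ℝ) ^ k * (n.choose k : ℝ) * P.eval (k : ℝ)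
      = (-1) ^ n * ∑ k ∈ Finset.range (n + 1),
        ((-1 : ℤ) ^ (n - k) * (n.choose k : ℤ)) • P.eval (0 + k • (1 : ℝ)) := by
    rw [Finset.mul_sum]
    refine Finset.sum_congr rfl fun k hk => ?_
    obtain ⟨m, rfl⟩ := Nat.exists_eq_add_of_le (Nat.lt_succ_iff.1 (Finset.mem_range.1 hk))
    have h3 : ((-1 : ℝ) ^ m) * (-1) ^ m = 1 := by rw [← mul_pow]; simp
    simp only [zsmul_eq_mul, nsmul_eq_mul, mul_one, zero_add, Nat.add_sub_cancel_left, pow_add]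
    push_cast
    linear_combination (-(-1 : ℝ) ^ k * ((k + m).choose k : ℝ) * P.eval (k : ℝ)) * h3
  rw [h2, ← h]
  simp

lemma poch_mul_poch_exchange (w : ℝ) {e k L : ℕ} (he : e ≤ L) (hk : k ≤ L) :
    poch (w + e) k * poch (w + k) (L - k) = poch (w + e) (L - e) * poch (w + k) e := by
  rcases le_total e k with h | h
  · obtain ⟨f, rfl⟩ := Nat.exists_eq_add_of_le h
    obtain ⟨r, rfl⟩ := Nat.exists_eq_add_of_le hk
    rw [Nat.add_sub_cancel_left, show e + f + r - e = f + r by omega, poch_add _ f r,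
      add_comm e f, poch_add _ f e, Nat.cast_add, show w + ((f : ℝ) + e) = w + e + f by ring]
    ring
  · obtain ⟨f, rfl⟩ := Nat.exists_eq_add_of_le h
    obtain ⟨r, rfl⟩ := Nat.exists_eq_add_of_le he
    rw [Nat.add_sub_cancel_left, show k + f + r - k = f + r by omega, poch_add _ f r,
      add_comm k f, poch_add _ f k, Nat.cast_add, show w + ((f : ℝ) + k) = w + k + f by ring]
    ring

lemma cast_descFactorial_sub {M k : ℕ} (h : k ≤ M) (j : ℕ) :
    (((M - k).descFactorial j : ℕ) : ℝ) = (-1) ^ j * poch ((k : ℝ) + -(M : ℝ)) j := by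
  rw [show (k : ℝ) + -(M : ℝ) = -((M - k : ℕ) : ℝ) by push_cast [Nat.cast_sub h]; ring,
    poch_neg_natCast, ← mul_assoc, ← mul_pow]
  simp

lemma sum_alternating_choose_poch_eq_zero (w : ℝ) {n j M : ℕ} (hj : j < n) (hn : n ≤ M) :
    ∑ k ∈ Finset.range (n + 1), (-1 : ℝ) ^ k * (n.choose k : ℝ)
      * (poch (w + (n - 1 - j : ℕ)) k * ((M - k).descFactorial j : ℝ)
        * poch (w + k) (M - (k + j))) = 0 := by
  set e := n - 1 - j with he
  let P : Polynomial ℝ := Polynomial.C ((-1) ^ j * poch (w + e) (M - j - e))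
    * (pochPoly (-(M : ℝ)) j * pochPoly w e)
  have hP : P.natDegree < n := by
    calc P.natDegree ≤ (pochPoly (-(M : ℝ)) j * pochPoly w e).natDegree :=
          Polynomial.natDegree_C_mul_le _ _
      _ ≤ j + e := Polynomial.natDegree_mul_le.trans
          (add_le_add (natDegree_pochPoly_le _ _) (natDegree_pochPoly_le _ _))
      _ < n := by omega
  rw [← sum_alternating_choose_eval_eq_zero P hP]
  refine Finset.sum_congr rfl fun k hk => ?_
  have hk' : k ≤ M := by have := Finset.mem_range.1 hk; omega
  congr 1
  simp only [P, Polynomial.eval_mul, Polynomial.eval_C, eval_pochPoly]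
  by_cases hkj : k + j ≤ M
  · have := poch_mul_poch_exchange w (e := e) (k := k) (L := M - j) (by omega) (by omega)
    rw [show M - (k + j) = M - j - k by omega, cast_descFactorial_sub hk', add_comm (k : ℝ) w]
    linear_combination ((-1) ^ j * poch ((k : ℝ) + -(M : ℝ)) j) * this
  · have h0 := cast_descFactorial_sub hk' j
    rw [Nat.descFactorial_of_lt (by omega), Nat.cast_zero] at h0
    rw [Nat.descFactorial_of_lt (by omega)]
    linear_combination poch (w + e) (M - j - e) * poch (k + w) e * h0

lemma sum_alternating_choose_poch (c : ℝ) {n M : ℕ} (hn : n ≤ M) :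
    ∑ k ∈ Finset.range (n + 1), (-1 : ℝ) ^ k * (n.choose k : ℝ)
      * (poch c k * ((M - k).descFactorial n : ℝ) * poch (c + 1 + k) (M - (k + n)))
      = n.factorial * poch (c + n + 1) (M - n) := by
  obtain ⟨r, rfl⟩ := Nat.exists_eq_add_of_le hn
  let F : Polynomial ℝ := ∑ k ∈ Finset.range (n + 1),
    Polynomial.C ((-1 : ℝ) ^ k * (n.choose k : ℝ) * ((n + r - k).descFactorial n : ℝ))
      * (pochPoly 0 k * pochPoly (1 + k) (r - k))
  let G : Polynomial ℝ := Polynomial.C (n.factorial : ℝ) * pochPoly (n + 1) r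
  have hF : F.natDegree ≤ r := by
    refine Polynomial.natDegree_sum_le_of_forall_le _ _ fun k hkn => ?_
    have hkn' := Finset.mem_range.1 hkn
    by_cases hk : k ≤ r
    · refine (Polynomial.natDegree_C_mul_le _ _).trans (Polynomial.natDegree_mul_le.trans
        ((add_le_add (natDegree_pochPoly_le _ _) (natDegree_pochPoly_le _ _)).trans ?_))
      omega
    · rw [Nat.descFactorial_of_lt (by omega)]
      simp
  have hG : G.natDegree ≤ r :=
    (Polynomial.natDegree_C_mul_le _ _).trans (natDegree_pochPoly_le _ _)
  have hlt : ∀ P : Polynomial ℝ, P.natDegree ≤ r → P.degree < #(Finset.range (r + 1)) :=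
    fun P hP => by
      rw [Finset.card_range]
      exact lt_of_le_of_lt (Polynomial.natDegree_le_iff_degree_le.1 hP)
        (by exact_mod_cast Nat.lt_succ_self r)
  have hFG : F = G := by
    refine Polynomial.eq_of_degrees_lt_of_eval_index_eq (Finset.range (r + 1))
      (v := fun i : ℕ => -(i : ℝ)) (fun a _ b _ h => by simpa using h) (hlt F hF) (hlt G hG) ?_
    intro i hi
    have hir : i ≤ r := Nat.lt_succ_iff.1 (Finset.mem_range.1 hi)
    simp only [F, G, Polynomial.eval_finsetSum, Polynomial.eval_mul, Polynomial.eval_C,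
      eval_pochPoly, add_zero]
    have hz : ∀ k ∈ Finset.range (n + 1), k ≠ i →
        (-1 : ℝ) ^ k * (n.choose k : ℝ) * ((n + r - k).descFactorial n : ℝ)
          * (poch (-(i : ℝ)) k * poch (-(i : ℝ) + (1 + k)) (r - k)) = 0 := by
      intro k _ hki
      rcases lt_or_gt_of_ne hki with h | h
      · rw [show -(i : ℝ) + (1 + k) = -((i - k - 1 : ℕ) : ℝ) by
            rw [Nat.sub_sub, Nat.cast_sub (by omega)]; push_cast; ring,
          poch_neg_natCast _ (r - k),
          Nat.descFactorial_of_lt (show i - k - 1 < r - k by omega)]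
        simp
      · rw [poch_neg_natCast, Nat.descFactorial_of_lt h]
        simp
    by_cases hin : i ≤ n
    · rw [Finset.sum_eq_single_of_mem i (Finset.mem_range.2 (by omega)) hz, poch_neg_natCast,
        Nat.descFactorial_self, show -(i : ℝ) + (1 + i) = (0 : ℕ) + 1 by push_cast; ring,
        show -(i : ℝ) + (n + 1) = ((n - i : ℕ) : ℝ) + 1 by
          rw [Nat.cast_sub hin]; ring]
      have h1 := poch_one_add_natCast 0 (r - i)
      have h2 := poch_one_add_natCast (n - i) r
      have h3 : ((n.choose i : ℕ) : ℝ) * (i.factorial : ℝ) * ((n - i).factorial : ℝ)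
          = (n.factorial : ℝ) := by exact_mod_cast Nat.choose_mul_factorial_mul_factorial hin
      have h4 : ((r - i).factorial : ℝ) * ((n + r - i).descFactorial n : ℝ)
          = ((n + r - i).factorial : ℝ) := by
        have := Nat.factorial_mul_descFactorial (n := n + r - i) (k := n) (by omega)
        rw [show n + r - i - n = r - i by omega] at this
        exact_mod_cast this
      have h5 : ((-1 : ℝ) ^ i) * (-1) ^ i = 1 := by rw [← mul_pow]; simp
      rw [zero_add, Nat.factorial_zero, Nat.cast_one, mul_one] at h1
      rw [show n - i + r = n + r - i by omega] at h2
      rw [h1, ← h3]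
      linear_combination (n.choose i * i.factorial : ℝ) * (h4 - h2)
        + (n.choose i * i.factorial * (n + r - i).descFactorial n * (r - i).factorial : ℝ) * h5
    · rw [Finset.sum_eq_zero fun k hk => hz k hk (by have := Finset.mem_range.1 hk; omega),
        show -(i : ℝ) + (n + 1) = -((i - n - 1 : ℕ) : ℝ) by
          rw [Nat.sub_sub, Nat.cast_sub (by omega)]; push_cast; ring,
        poch_neg_natCast, Nat.descFactorial_of_lt (by omega)]
      simp
  have h := congrArg (Polynomial.eval c) hFG
  simp only [F, G, Polynomial.eval_finsetSum, Polynomial.eval_mul, Polynomial.eval_C,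
    eval_pochPoly, add_zero] at h
  rw [Nat.add_sub_cancel_left, add_assoc, ← h]
  refine Finset.sum_congr rfl fun k _ => ?_
  rw [show n + r - (k + n) = r - k by omega, add_assoc]
  ring

/-- The Hahn polynomial normalised so that it is polynomial in all parameters. -/
noncomputable def hahnNormalized (n : ℕ) (x a b M : ℝ) : ℝ := poch (a + 1) n * hahnQM n x a b M

/-- Coefficients of `hahnNormalized` in the basis `(-x)_k`. -/
noncomputable def hahnCoeff (n : ℕ) (a b M : ℝ) (k : ℕ) : ℝ :=
  poch (-(n : ℝ)) k * poch (n + a + b + 1) k * poch (-M + k) (n - k)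
    * poch (a + 1 + k) (n - k) / (k.factorial : ℝ)

lemma hahnNormalized_eq_sum (n : ℕ) (x a b M : ℝ) (ha : poch (a + 1) n ≠ 0) :
    hahnNormalized n x a b M
      = ∑ k ∈ Finset.range (n + 1), hahnCoeff n a b M k * poch (-x) k := by
  rw [hahnNormalized, hahnQM, Finset.mul_sum]
  refine Finset.sum_congr rfl fun k hk => ?_
  have hk' : k ≤ n := Nat.lt_succ_iff.1 (Finset.mem_range.1 hk)
  have h := poch_add (a + 1) k (n - k)
  rw [Nat.add_sub_cancel' hk'] at h
  have h0 : poch (a + 1) k ≠ 0 := fun h0 => ha (by rw [h, h0, zero_mul])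
  rw [h, hahnCoeff]
  field_simp

lemma hahnNormalized_eq_zero {n M x : ℕ} (a b : ℝ) (ha : poch (a + 1) n ≠ 0) (hx : x ≤ M)
    (hM : M < n) : hahnNormalized n x a b M = 0 := by
  rw [hahnNormalized_eq_sum _ _ _ _ _ ha]
  refine Finset.sum_eq_zero fun k _ => ?_
  rcases le_or_gt k x with h | h
  · rw [hahnCoeff, show -(M : ℝ) + k = -((M - k : ℕ) : ℝ) by
      rw [Nat.cast_sub (by omega)]; ring, poch_neg_natCast _ (n - k),
      Nat.descFactorial_of_lt (by omega)]
    simp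
  · rw [poch_neg_natCast, Nat.descFactorial_of_lt h]
    simp

lemma hahnCoeff_mul_moment (a b : ℝ) {n M j k : ℕ} (hk : k ≤ n) (hn : n ≤ M) :
    hahnCoeff n a b M k * (if k + j ≤ M then
      (-1) ^ (k + j) * poch (a + 1) k * poch (b + 1) j
        * pochDiv (a + 1 + (b + 1) + k + j) (M - (k + j)) else 0)
    = (-1) ^ (n + j) * poch (a + 1) n * poch (b + 1) j / ((M - n).factorial : ℝ)
      * ((-1 : ℝ) ^ k * (n.choose k : ℝ)
        * (poch (n + a + b + 1) k * ((M - k).descFactorial j : ℝ)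
          * poch (a + b + 2 + j + k) (M - (k + j)))) := by
  by_cases hkj : k + j ≤ M
  · rw [if_pos hkj, hahnCoeff, pochDiv]
    have e1 := poch_add (a + 1) k (n - k)
    rw [Nat.add_sub_cancel' hk] at e1
    rw [show -(M : ℝ) + k = -((M - k : ℕ) : ℝ) by rw [Nat.cast_sub (by omega)]; ring,
      poch_neg_natCast, poch_neg_natCast, e1,
      show a + 1 + (b + 1) + (k : ℝ) + j = a + b + 2 + j + k by ring]
    have e2 : (n.descFactorial k : ℝ) = k.factorial * n.choose k := by
      exact_mod_cast Nat.descFactorial_eq_factorial_mul_choose n k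
    have e3 : ((M - n).factorial : ℝ) * ((M - k).descFactorial (n - k) : ℝ)
        = ((M - k).factorial : ℝ) := by
      have := Nat.factorial_mul_descFactorial (n := M - k) (k := n - k) (by omega)
      rw [show M - k - (n - k) = M - n by omega] at this
      exact_mod_cast this
    have e4 : ((M - (k + j)).factorial : ℝ) * ((M - k).descFactorial j : ℝ)
        = ((M - k).factorial : ℝ) := by
      have := Nat.factorial_mul_descFactorial (n := M - k) (k := j) (by omega)
      rw [show M - k - j = M - (k + j) by omega] at this
      exact_mod_cast this
    have e5 : ((-1 : ℝ) ^ k) * (-1) ^ (n - k) * (-1) ^ (k + j) = (-1) ^ (n + j) * (-1) ^ k := by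
      rw [← pow_add, ← pow_add, ← pow_add]
      congr 1
      omega
    have f1 : (k.factorial : ℝ) ≠ 0 := by positivity
    have f2 : ((M - n).factorial : ℝ) ≠ 0 := by positivity
    have f3 : ((M - (k + j)).factorial : ℝ) ≠ 0 := by positivity
    have e6 : ((M - k).descFactorial (n - k) : ℝ) / ((M - (k + j)).factorial : ℝ)
        = ((M - k).descFactorial j : ℝ) / ((M - n).factorial : ℝ) := by
      rw [div_eq_div_iff f3 f2]
      linear_combination e3 - e4
    rw [e2]
    calc _ = ((-1 : ℝ) ^ k * (-1) ^ (n - k) * (-1) ^ (k + j))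
          * (((M - k).descFactorial (n - k) : ℝ) / ((M - (k + j)).factorial : ℝ))
          * (n.choose k * poch (n + a + b + 1) k * poch (a + 1 + k) (n - k) * poch (a + 1) k
            * poch (b + 1) j * poch (a + b + 2 + j + k) (M - (k + j))) := by
          field_simp
      _ = _ := by
          rw [e5, e6]
          ring
  · rw [if_neg hkj, Nat.descFactorial_of_lt (by omega)]
    simp

/-- The inner products of a Hahn polynomial with the shifted factorials `(-y)_j`, `y = M - x`. -/
lemma sum_hahnNormalized_mul_poch (a b : ℝ) {n M j : ℕ} (ha : poch (a + 1) n ≠ 0) (hn : n ≤ M)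
    (hj : j ≤ n) :
    ∑ p ∈ antidiagonal M, hahnNormalized n p.1 a b M
        * (pochDiv (a + 1) p.1 * pochDiv (b + 1) p.2) * poch (-(p.2 : ℝ)) j
      = if j = n then poch (a + 1) n * poch (b + 1) n * n.factorial
          * pochDiv (2 * n + a + b + 2) (M - n) else 0 := by
  have h : ∑ p ∈ antidiagonal M, hahnNormalized n p.1 a b M
        * (pochDiv (a + 1) p.1 * pochDiv (b + 1) p.2) * poch (-(p.2 : ℝ)) j
      = (-1) ^ (n + j) * poch (a + 1) n * poch (b + 1) j / ((M - n).factorial : ℝ)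
        * ∑ k ∈ Finset.range (n + 1), (-1 : ℝ) ^ k * (n.choose k : ℝ)
          * (poch (n + a + b + 1) k * ((M - k).descFactorial j : ℝ)
            * poch (a + b + 2 + j + k) (M - (k + j))) := by
    simp only [hahnNormalized_eq_sum _ _ _ _ _ ha, Finset.sum_mul]
    rw [Finset.sum_comm, Finset.mul_sum]
    refine Finset.sum_congr rfl fun k hk => ?_
    rw [← hahnCoeff_mul_moment a b (Nat.lt_succ_iff.1 (Finset.mem_range.1 hk)) hn,
      ← sum_antidiagonal_poch_mul_poch, Finset.mul_sum]
    exact Finset.sum_congr rfl fun p _ => by ring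
  rw [h]
  split_ifs with hjn
  · subst hjn
    have h2 := sum_alternating_choose_poch ((j : ℝ) + a + b + 1) hn
    rw [show a + b + 2 + (j : ℝ) = (j : ℝ) + a + b + 1 + 1 by ring, h2, pochDiv,
      show (j : ℝ) + a + b + 1 + j + 1 = 2 * j + a + b + 2 by ring, pow_add, ← mul_pow]
    norm_num
    ring
  · have h2 := sum_alternating_choose_poch_eq_zero (a + b + 2 + j) (lt_of_le_of_ne hj hjn) hn
    rw [show a + b + 2 + (j : ℝ) + ((n - 1 - j : ℕ) : ℝ) = n + a + b + 1 by
      rw [Nat.sub_sub, Nat.cast_sub (by omega)]; push_cast; ring] at h2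
    rw [h2, mul_zero]

/-- A function on the antidiagonal that is orthogonal to `(-y)_i` for `i < n` pairs with
`(-x)_k (-y)_i`, `k + i ≤ n`, through the leading term only. -/
lemma sum_mul_poch_mul_poch_of_orthogonal (M n : ℕ) (f : ℕ × ℕ → ℝ) (Λ : ℝ)
    (hf : ∀ i ≤ n, ∑ p ∈ antidiagonal M, f p * poch (-(p.2 : ℝ)) i = if i = n then Λ else 0)
    (k i : ℕ) (hki : k + i ≤ n) :
    ∑ p ∈ antidiagonal M, f p * (poch (-(p.1 : ℝ)) k * poch (-(p.2 : ℝ)) i)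
      = if k + i = n then (-1) ^ k * Λ else 0 := by
  induction k generalizing i with
  | zero => simpa using hf i (by omega)
  | succ k ih =>
    have h : ∀ p ∈ antidiagonal M, f p * (poch (-(p.1 : ℝ)) (k + 1) * poch (-(p.2 : ℝ)) i)
        = -(f p * (poch (-(p.1 : ℝ)) k * poch (-(p.2 : ℝ)) (i + 1)))
          + ((i : ℝ) - M + k) * (f p * (poch (-(p.1 : ℝ)) k * poch (-(p.2 : ℝ)) i)) :=
      fun p hp => by
        have : (p.1 : ℝ) + p.2 = M := by exact_mod_cast mem_antidiagonal.1 hp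
        rw [poch_succ, poch_succ, ← this]
        ring
    rw [Finset.sum_congr rfl h, Finset.sum_add_distrib, Finset.sum_neg_distrib, ← Finset.mul_sum,
      ih (i + 1) (by omega), ih i (by omega), if_neg (show k + i ≠ n by omega),
      show k + (i + 1) = k + 1 + i by omega]
    split_ifs <;> ring

/-- Orthogonality of the Hahn polynomials of one variable. -/
lemma sum_hahnNormalized_mul_hahnNormalized (a b : ℝ) (n m M : ℕ) (hn : poch (a + 1) n ≠ 0)
    (hm : poch (a + 1) m ≠ 0) :
    ∑ p ∈ antidiagonal M, hahnNormalized n p.1 a b M * hahnNormalized m p.1 a b M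
        * (pochDiv (a + 1) p.1 * pochDiv (b + 1) p.2)
      = if n = m ∧ n ≤ M then poch (a + 1) n * poch (b + 1) n * n.factorial
          * poch (n + a + b + 1) n * pochDiv (2 * n + a + b + 2) (M - n) else 0 := by
  wlog hmn : m ≤ n generalizing n m
  · rw [if_neg (by omega), ← (this m n hm hn (by omega)).trans (if_neg (by omega))]
    exact Finset.sum_congr rfl fun p _ => by ring
  by_cases hnM : n ≤ M
  · have key : ∀ k ≤ n, ∑ p ∈ antidiagonal M, (hahnNormalized n p.1 a b M
        * (pochDiv (a + 1) p.1 * pochDiv (b + 1) p.2)) * poch (-(p.1 : ℝ)) k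
        = if k = n then (-1) ^ k * (poch (a + 1) n * poch (b + 1) n * n.factorial
          * pochDiv (2 * n + a + b + 2) (M - n)) else 0 := fun k hk => by
      simpa using sum_mul_poch_mul_poch_of_orthogonal M n _ _
        (fun i hi => sum_hahnNormalized_mul_poch a b hn hnM hi) k 0 (by omega)
    have h : ∑ p ∈ antidiagonal M, hahnNormalized n p.1 a b M * hahnNormalized m p.1 a b M
        * (pochDiv (a + 1) p.1 * pochDiv (b + 1) p.2)
        = ∑ k ∈ Finset.range (m + 1), hahnCoeff m a b M k * (if k = n then
          (-1) ^ k * (poch (a + 1) n * poch (b + 1) n * n.factorial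
          * pochDiv (2 * n + a + b + 2) (M - n)) else 0) := by
      simp only [hahnNormalized_eq_sum m _ _ _ _ hm, Finset.sum_mul, Finset.mul_sum]
      rw [Finset.sum_comm]
      refine Finset.sum_congr rfl fun k hk => ?_
      rw [← key k (by have := Finset.mem_range.1 hk; omega), Finset.mul_sum]
      exact Finset.sum_congr rfl fun p _ => by ring
    rw [h, Finset.sum_range_succ, Finset.sum_eq_zero fun k hk => by
      rw [if_neg (by have := Finset.mem_range.1 hk; omega), mul_zero], zero_add]
    by_cases hnm : n = m
    · subst hnm
      have e : ((-1 : ℝ) ^ n) * (-1) ^ n = 1 := by rw [← mul_pow]; simp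
      have f : (n.factorial : ℝ) ≠ 0 := by positivity
      rw [if_pos rfl, if_pos ⟨rfl, hnM⟩, hahnCoeff, poch_neg_natCast, Nat.descFactorial_self,
        Nat.sub_self, poch_zero, poch_zero]
      calc _ = ((-1 : ℝ) ^ n * (-1) ^ n) * ((n.factorial : ℝ) / n.factorial)
            * (poch (a + 1) n * poch (b + 1) n * n.factorial * poch (n + a + b + 1) n
              * pochDiv (2 * n + a + b + 2) (M - n)) := by ring
        _ = _ := by rw [e, div_self f, one_mul, one_mul]
    · rw [if_neg (Ne.symm hnm), if_neg (by tauto), mul_zero]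
  · rw [if_neg (by omega)]
    refine Finset.sum_eq_zero fun p hp => ?_
    have hp' := mem_antidiagonal.1 hp
    rw [hahnNormalized_eq_zero a b hn (show p.1 ≤ M by omega) (by omega)]
    ring

/-- The lattice points of the simplex `|x| ≤ N`. -/
abbrev latticeSimplex (d N : ℕ) : Finset (Fin d → ℕ) :=
  Finset.filter (fun x => ∑ i, x i ≤ N) (Finset.Iic fun _ : Fin d => N)

lemma mem_latticeSimplex {d N : ℕ} {x : Fin d → ℕ} :
    x ∈ latticeSimplex d N ↔ ∑ i, x i ≤ N := by
  simp only [latticeSimplex, Finset.mem_filter, Finset.mem_Iic, and_iff_right_iff_imp]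
  intro h i
  exact (Finset.single_le_sum (f := x) (fun _ _ => Nat.zero_le _) (Finset.mem_univ i)).trans h

lemma sum_snoc {M : Type*} [AddCommMonoid M] {d : ℕ} (x : Fin d → M) (y : M) :
    ∑ i, (Fin.snoc x y : Fin (d + 1) → M) i = ∑ i, x i + y := by
  simp [Fin.sum_univ_castSucc]

lemma sum_latticeSimplex_succ (d N : ℕ) (f : (Fin (d + 1) → ℕ) → ℝ) :
    ∑ x ∈ latticeSimplex (d + 1) N, f x
      = ∑ x ∈ latticeSimplex d N, ∑ p ∈ antidiagonal (N - ∑ i, x i), f (Fin.snoc x p.1) := by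
  rw [Finset.sum_sigma']
  refine Finset.sum_bij' (fun x _ => ⟨Fin.init x, (x (Fin.last d), N - ∑ i, x i)⟩)
    (fun q _ => Fin.snoc q.1 q.2.1) ?_ ?_ ?_ ?_ ?_
  · intro x hx
    rw [mem_latticeSimplex, Fin.sum_univ_castSucc] at hx
    simp only [Finset.mem_sigma, mem_latticeSimplex, HasAntidiagonal.mem_antidiagonal, Fin.init,
      Fin.sum_univ_castSucc x]
    omega
  · rintro ⟨x, y, z⟩ hq
    simp only [Finset.mem_sigma, mem_latticeSimplex, HasAntidiagonal.mem_antidiagonal] at hq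
    simp only [mem_latticeSimplex, sum_snoc]
    omega
  · intro x _
    exact Fin.snoc_init_self x
  · rintro ⟨x, y, z⟩ hq
    simp only [Finset.mem_sigma, mem_latticeSimplex, HasAntidiagonal.mem_antidiagonal] at hq
    have hz : N - (∑ i, x i + y) = z := by omega
    simp [Fin.init_snoc, hz]
  · intro x _
    exact congrArg f (Fin.snoc_init_self x).symm

/-- The parameters of the Hahn polynomials in one variable less. -/
noncomputable def mergeLast {d : ℕ} (σ : Fin (d + 2) → ℝ) (n : ℕ) : Fin (d + 1) → ℝ :=
  Fin.snoc (fun i : Fin d => σ i.castSucc.castSucc)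
    (σ (Fin.last d).castSucc + σ (Fin.last (d + 1)) + 2 * n + 1)

lemma mergeLast_castSucc {d : ℕ} (σ : Fin (d + 2) → ℝ) (n : ℕ) (i : Fin d) :
    mergeLast σ n i.castSucc = σ i.castSucc.castSucc := by
  simp [mergeLast]

lemma mergeLast_last {d : ℕ} (σ : Fin (d + 2) → ℝ) (n : ℕ) :
    mergeLast σ n (Fin.last d)
      = σ (Fin.last d).castSucc + σ (Fin.last (d + 1)) + 2 * n + 1 := by
  simp [mergeLast]

lemma sum_mergeLast {d : ℕ} (σ : Fin (d + 2) → ℝ) (n : ℕ) :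
    ∑ i, mergeLast σ n i = ∑ i, σ i + 2 * n + 1 := by
  rw [mergeLast, sum_snoc, Fin.sum_univ_castSucc σ, Fin.sum_univ_castSucc]
  ring

lemma aHahn_snoc_castSucc {d : ℕ} (σ : Fin (d + 2) → ℝ) (ν : Fin d → ℕ) (n : ℕ) (j : Fin d) :
    aHahn (d + 1) σ (Fin.snoc ν n : Fin (d + 1) → ℕ) j.castSucc
      = aHahn d (mergeLast σ n) ν j := by
  have hj : (j : ℕ) + 1 ≤ d := j.isLt
  simp only [aHahn, tailFrom, Fin.sum_univ_castSucc, Fin.val_castSucc, Fin.val_last,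
    Fin.snoc_castSucc, Fin.snoc_last, mergeLast_castSucc, mergeLast_last, if_pos hj,
    if_pos (hj.trans (Nat.le_succ d))]
  push_cast
  ring

lemma aHahn_last {d : ℕ} (σ : Fin (d + 2) → ℝ) (ν : Fin (d + 1) → ℕ) :
    aHahn (d + 1) σ ν (Fin.last d) = σ (Fin.last (d + 1)) := by
  have h : ∀ i : Fin d, ¬ d < (i : ℕ) := fun i => by have := i.isLt; omega
  simp [aHahn, tailFrom, Fin.sum_univ_castSucc, h]

/-- The unnormalised Hahn polynomials of several variables. -/
noncomputable def hahnProd (d : ℕ) (σ : Fin (d + 1) → ℝ) (N : ℝ) (ν x : Fin d → ℕ) : ℝ :=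
  ∏ j, hahnNormalized (ν j) (x j) (σ j.castSucc) (aHahn d σ ν j)
    (N - headTo d (fun i => (x i : ℝ)) j - tailFrom d (fun i => (ν i : ℝ)) (j.val + 1))

lemma hahnProd_snoc {d : ℕ} (σ : Fin (d + 2) → ℝ) (N : ℝ) (ν x : Fin d → ℕ) (n y : ℕ) :
    hahnProd (d + 1) σ N (Fin.snoc ν n : Fin (d + 1) → ℕ) (Fin.snoc x y : Fin (d + 1) → ℕ)
      = hahnProd d (mergeLast σ n) (N - n) ν x
        * hahnNormalized n y (σ (Fin.last d).castSucc) (σ (Fin.last (d + 1)))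
          (N - ∑ i, (x i : ℝ)) := by
  rw [hahnProd, Fin.prod_univ_castSucc, hahnProd]
  congr 1
  · refine Finset.prod_congr rfl fun j _ => ?_
    have hj : (j : ℕ) + 1 ≤ d := j.isLt
    have hj' : ¬ d < (j : ℕ) := by omega
    rw [aHahn_snoc_castSucc, mergeLast_castSucc, Fin.snoc_castSucc, Fin.snoc_castSucc]
    congr 1
    simp only [headTo, tailFrom, Fin.sum_univ_castSucc, Fin.val_castSucc, Fin.val_last,
      Fin.snoc_castSucc, Fin.snoc_last, if_pos hj, if_neg hj']
    ring
  · have h : ∀ i : Fin d, ¬ d < (i : ℕ) := fun i => by have := i.isLt; omega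
    rw [aHahn_last, Fin.snoc_last, Fin.snoc_last]
    congr 1
    simp [headTo, tailFrom, Fin.sum_univ_castSucc, h]

lemma genBinom_add_natCast (s : ℝ) (k : ℕ) : genBinom ((k : ℝ) + s) k = pochDiv (s + 1) k := by
  rw [genBinom, pochDiv, show (k : ℝ) + s - k + 1 = s + 1 by ring]

lemma Whahn_eq {d N : ℕ} (σ : Fin (d + 1) → ℝ) {x : Fin d → ℕ} (hx : ∑ i, x i ≤ N) :
    Whahn d σ N x = (∏ i, pochDiv (σ i.castSucc + 1) (x i))
      * pochDiv (σ (Fin.last d) + 1) (N - ∑ i, x i) := by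
  rw [Whahn, ← Nat.cast_sub hx, genBinom_add_natCast]
  simp only [genBinom_add_natCast]

lemma Whahn_snoc {d N : ℕ} (σ : Fin (d + 2) → ℝ) {x : Fin d → ℕ} {y z : ℕ}
    (hx : ∑ i, x i ≤ N) (h : y + z = N - ∑ i, x i) :
    Whahn (d + 1) σ N (Fin.snoc x y : Fin (d + 1) → ℕ)
      = (∏ i : Fin d, pochDiv (σ i.castSucc.castSucc + 1) (x i))
        * (pochDiv (σ (Fin.last d).castSucc + 1) y * pochDiv (σ (Fin.last (d + 1)) + 1) z) := by
  rw [Whahn_eq σ (by rw [sum_snoc]; omega), Fin.prod_univ_castSucc, sum_snoc,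
    show N - (∑ i, x i + y) = z by omega]
  simp only [Fin.snoc_castSucc, Fin.snoc_last]
  ring

/-- Orthogonality of the unnormalised Hahn polynomials of several variables. -/
lemma sum_hahnProd_mul_hahnProd (d : ℕ) (σ : Fin (d + 1) → ℝ) (N : ℕ) (ν μ : Fin d → ℕ)
    (hν : ∑ i, ν i ≤ N) (hμ : ∑ i, μ i ≤ N)
    (hν0 : ∀ j, poch (σ j.castSucc + 1) (ν j) ≠ 0)
    (hμ0 : ∀ j, poch (σ j.castSucc + 1) (μ j) ≠ 0) :
    ∑ x ∈ latticeSimplex d N, hahnProd d σ N ν x * hahnProd d σ N μ x * Whahn d σ N x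
      = if ν = μ then
          pochDiv (∑ i, σ i + d + 2 * ((∑ i, ν i : ℕ) : ℝ) + 1) (N - ∑ i, ν i)
            * ∏ j, poch (σ j.castSucc + 1) (ν j) * poch (aHahn d σ ν j + 1) (ν j)
              * (ν j).factorial * poch (ν j + σ j.castSucc + aHahn d σ ν j + 1) (ν j)
        else 0 := by
  induction d generalizing N with
  | zero =>
    have h : latticeSimplex 0 N = {ν} := by
      ext x
      simp [Subsingleton.elim x ν]
    rw [h, Finset.sum_singleton, if_pos (Subsingleton.elim _ _), Whahn_eq σ hν]
    simp [hahnProd]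
  | succ d ih =>
    obtain ⟨ν', n, rfl⟩ : ∃ (ν' : Fin d → ℕ) (n : ℕ), ν = (Fin.snoc ν' n : Fin (d + 1) → ℕ) :=
      ⟨Fin.init ν, ν (Fin.last d), (Fin.snoc_init_self ν).symm⟩
    obtain ⟨μ', m, rfl⟩ : ∃ (μ' : Fin d → ℕ) (m : ℕ), μ = (Fin.snoc μ' m : Fin (d + 1) → ℕ) :=
      ⟨Fin.init μ, μ (Fin.last d), (Fin.snoc_init_self μ).symm⟩
    rw [sum_snoc] at hν hμ
    have hn0 := hν0 (Fin.last d)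
    have hm0 := hμ0 (Fin.last d)
    rw [Fin.snoc_last] at hn0 hm0
    have hν0' : ∀ (k : ℕ) (j : Fin d), poch (mergeLast σ k j.castSucc + 1) (ν' j) ≠ 0 := by
      intro k j
      simpa [mergeLast_castSucc] using hν0 j.castSucc
    have hμ0' : ∀ (k : ℕ) (j : Fin d), poch (mergeLast σ k j.castSucc + 1) (μ' j) ≠ 0 := by
      intro k j
      simpa [mergeLast_castSucc] using hμ0 j.castSucc
    set a := σ (Fin.last d).castSucc with ha
    set b := σ (Fin.last (d + 1)) with hb
    have hinner : ∀ x ∈ latticeSimplex d N, ∑ p ∈ antidiagonal (N - ∑ i, x i),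
        hahnProd (d + 1) σ N (Fin.snoc ν' n : Fin (d + 1) → ℕ)
            (Fin.snoc x p.1 : Fin (d + 1) → ℕ)
          * hahnProd (d + 1) σ N (Fin.snoc μ' m : Fin (d + 1) → ℕ)
            (Fin.snoc x p.1 : Fin (d + 1) → ℕ)
          * Whahn (d + 1) σ N (Fin.snoc x p.1 : Fin (d + 1) → ℕ)
        = hahnProd d (mergeLast σ n) (N - n) ν' x * hahnProd d (mergeLast σ m) (N - m) μ' x
          * (∏ i : Fin d, pochDiv (σ i.castSucc.castSucc + 1) (x i))
          * (if n = m ∧ n ≤ N - ∑ i, x i then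
              poch (a + 1) n * poch (b + 1) n * n.factorial * poch (n + a + b + 1) n
                * pochDiv (2 * n + a + b + 2) (N - ∑ i, x i - n) else 0) := by
      intro x hx
      have hx' := mem_latticeSimplex.1 hx
      rw [← sum_hahnNormalized_mul_hahnNormalized a b n m _ hn0 hm0, Finset.mul_sum]
      refine Finset.sum_congr rfl fun p hp => ?_
      rw [Whahn_snoc σ hx' (mem_antidiagonal.1 hp), hahnProd_snoc, hahnProd_snoc,
        Nat.cast_sub hx', Nat.cast_sum]
      ring
    rw [sum_latticeSimplex_succ, Finset.sum_congr rfl hinner]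
    by_cases hnm : n = m
    · subst hnm
      have hsub : latticeSimplex d (N - n) ⊆ latticeSimplex d N := fun x hx => by
        rw [mem_latticeSimplex] at hx ⊢
        omega
      rw [← Finset.sum_subset hsub fun x hx hx' => by
        rw [mem_latticeSimplex] at hx hx'
        rw [if_neg (by omega), mul_zero]]
      have hterm : ∀ x ∈ latticeSimplex d (N - n),
          hahnProd d (mergeLast σ n) (N - n) ν' x * hahnProd d (mergeLast σ n) (N - n) μ' x
          * (∏ i : Fin d, pochDiv (σ i.castSucc.castSucc + 1) (x i))
          * (if n = n ∧ n ≤ N - ∑ i, x i then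
              poch (a + 1) n * poch (b + 1) n * n.factorial * poch (n + a + b + 1) n
                * pochDiv (2 * n + a + b + 2) (N - ∑ i, x i - n) else 0)
          = poch (a + 1) n * poch (b + 1) n * n.factorial * poch (n + a + b + 1) n
            * (hahnProd d (mergeLast σ n) (N - n : ℕ) ν' x
              * hahnProd d (mergeLast σ n) (N - n : ℕ) μ' x
              * Whahn d (mergeLast σ n) (N - n) x) := by
        intro x hx
        rw [mem_latticeSimplex] at hx
        rw [if_pos ⟨rfl, by omega⟩, Whahn_eq _ hx, Nat.cast_sub (by omega), mergeLast_last,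
          Nat.sub_right_comm, ← ha, ← hb,
          show a + b + 2 * (n : ℝ) + 1 + 1 = 2 * n + a + b + 2 by ring]
        simp only [mergeLast_castSucc]
        ring
      rw [Finset.sum_congr rfl hterm, ← Finset.mul_sum,
        ih (mergeLast σ n) (N - n) ν' μ' (by omega) (by omega) (hν0' n) (hμ0' n)]
      by_cases hνμ : ν' = μ'
      · subst hνμ
        rw [if_pos rfl, if_pos rfl, sum_mergeLast, sum_snoc, Fin.prod_univ_castSucc, aHahn_last,
          ← ha, ← hb, Fin.snoc_last, show N - n - ∑ i, ν' i = N - (∑ i, ν' i + n) by omega,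
          show ∑ i, σ i + 2 * (n : ℝ) + 1 + d + 2 * ((∑ i, ν' i : ℕ) : ℝ) + 1
            = ∑ i, σ i + ((d + 1 : ℕ) : ℝ) + 2 * ((∑ i, ν' i + n : ℕ) : ℝ) + 1 by
            push_cast; ring]
        simp only [aHahn_snoc_castSucc, Fin.snoc_castSucc, mergeLast_castSucc]
        ring
      · rw [if_neg hνμ, mul_zero, if_neg fun h => hνμ (Fin.snoc_inj.1 h).1]
    · rw [if_neg fun h => hnm (Fin.snoc_inj.1 h).2]
      exact Finset.sum_eq_zero fun x _ => by rw [if_neg fun h => hnm h.1, mul_zero]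

lemma hahnNu_eq_mul_hahnProd (d : ℕ) (σ : Fin (d + 1) → ℝ) (N : ℕ) (ν x : Fin d → ℕ) :
    hahnNu d σ N ν x = (-1 : ℝ) ^ (∑ i, ν i) / poch (-(N : ℝ)) (∑ i, ν i)
      * (∏ j, (poch (aHahn d σ ν j + 1) (ν j))⁻¹) * hahnProd d σ N ν x := by
  rw [hahnNu, hahnProd, mul_assoc, ← Finset.prod_mul_distrib]
  congr 1
  refine Finset.prod_congr rfl fun j _ => ?_
  rw [hahnNormalized]
  ring

lemma AnuHahn_eq {d N : ℕ} (σ : Fin (d + 1) → ℝ) {ν : Fin d → ℕ} (hν : ∑ i, ν i ≤ N) :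
    AnuHahn d σ N ν = ((-1 : ℝ) ^ (∑ i, ν i) / poch (-(N : ℝ)) (∑ i, ν i)
        * ∏ j, (poch (aHahn d σ ν j + 1) (ν j))⁻¹) ^ 2
      * (pochDiv (∑ i, σ i + d + 2 * ((∑ i, ν i : ℕ) : ℝ) + 1) (N - ∑ i, ν i)
        * ∏ j, poch (σ j.castSucc + 1) (ν j) * poch (aHahn d σ ν j + 1) (ν j)
          * (ν j).factorial * poch (ν j + σ j.castSucc + aHahn d σ ν j + 1) (ν j)) := by
  have hprod : (∏ j, poch (σ j.castSucc + aHahn d σ ν j + (ν j : ℝ) + 1) (ν j)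
        * poch (σ j.castSucc + 1) (ν j) * (Nat.factorial (ν j) : ℝ)
        / poch (aHahn d σ ν j + 1) (ν j))
      = (∏ j, (poch (aHahn d σ ν j + 1) (ν j))⁻¹) ^ 2
        * ∏ j, poch (σ j.castSucc + 1) (ν j) * poch (aHahn d σ ν j + 1) (ν j)
          * (ν j).factorial * poch (ν j + σ j.castSucc + aHahn d σ ν j + 1) (ν j) := by
    rw [← Finset.prod_pow, ← Finset.prod_mul_distrib]
    refine Finset.prod_congr rfl fun j _ => ?_
    rw [show σ j.castSucc + aHahn d σ ν j + (ν j : ℝ) + 1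
      = ν j + σ j.castSucc + aHahn d σ ν j + 1 by ring]
    by_cases h : poch (aHahn d σ ν j + 1) (ν j) = 0
    · simp [h]
    · field_simp
  rw [AnuHahn, hprod, pochDiv]
  have hfac : ((N - ∑ i, ν i).factorial : ℝ) * (N.descFactorial (∑ i, ν i) : ℝ)
      = (N.factorial : ℝ) := by exact_mod_cast Nat.factorial_mul_descFactorial hν
  have h1 : ((N - ∑ i, ν i).factorial : ℝ) ≠ 0 := by positivity
  have h2 : (N.descFactorial (∑ i, ν i) : ℝ) ≠ 0 := fun h => by
    have : (N.factorial : ℝ) ≠ 0 := by positivity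
    rw [h, mul_zero] at hfac
    exact this hfac.symm
  rw [poch_neg_natCast, ← hfac]
  field_simp

lemma poch_ne_zero {N k : ℕ} {s : ℝ} (hs : -1 < s ∨ s < -(N : ℝ)) (hk : k ≤ N) :
    poch (s + 1) k ≠ 0 := by
  refine Finset.prod_ne_zero_iff.2 fun i hi => ?_
  have hi' : (i : ℝ) + 1 ≤ N := by
    have := Finset.mem_range.1 hi
    exact_mod_cast (show i + 1 ≤ N by omega)
  rcases hs with h | h
  · have : (0 : ℝ) ≤ i := Nat.cast_nonneg i
    exact ne_of_gt (by linarith)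
  · exact ne_of_lt (by linarith)

/-- Theorem 5.4: orthogonality of the Hahn polynomials of several variables on
the simplex `V^d_N = {x ∈ ℕ₀^d : |x| ≤ N}`, with the explicit norm `A_ν`. -/
theorem hahnNu_orthogonality (d : ℕ) (hd : 1 ≤ d) (N : ℕ) (hN : 0 < N)
    (σ : Fin (d + 1) → ℝ)
    (hσ : (∀ i, -1 < σ i)
      ∨ ((∀ i, σ i < -(N : ℝ)) ∧ ∀ i, ∀ z : ℤ, σ i ≠ (z : ℝ)))
    (ν μ : Fin d → ℕ) (hν : ∑ i, ν i ≤ N) (hμ : ∑ i, μ i ≤ N) :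
    ∑ x ∈ Finset.filter (fun x => ∑ i, x i ≤ N) (Finset.Iic fun _ : Fin d => N),
        hahnNu d σ N ν x * hahnNu d σ N μ x * Whahn d σ N x
      = if ν = μ then AnuHahn d σ N ν else 0 := by
  have hσ' : ∀ i, -1 < σ i ∨ σ i < -(N : ℝ) := fun i =>
    hσ.imp (fun h => h i) fun h => h.1 i
  have hle : ∀ (κ : Fin d → ℕ), ∑ i, κ i ≤ N → ∀ j, poch (σ j.castSucc + 1) (κ j) ≠ 0 :=
    fun κ hκ j => poch_ne_zero (hσ' _)
      ((Finset.single_le_sum (f := κ) (fun _ _ => Nat.zero_le _) (Finset.mem_univ j)).trans hκ)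
  have key := sum_hahnProd_mul_hahnProd d σ N ν μ hν hμ (hle ν hν) (hle μ hμ)
  have h : ∀ x : Fin d → ℕ, hahnNu d σ N ν x * hahnNu d σ N μ x * Whahn d σ N x
      = ((-1 : ℝ) ^ (∑ i, ν i) / poch (-(N : ℝ)) (∑ i, ν i)
          * (∏ j, (poch (aHahn d σ ν j + 1) (ν j))⁻¹))
        * ((-1 : ℝ) ^ (∑ i, μ i) / poch (-(N : ℝ)) (∑ i, μ i)
          * (∏ j, (poch (aHahn d σ μ j + 1) (μ j))⁻¹))
        * (hahnProd d σ N ν x * hahnProd d σ N μ x * Whahn d σ N x) := fun x => by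
    rw [hahnNu_eq_mul_hahnProd, hahnNu_eq_mul_hahnProd]
    ring
  simp only [h, ← Finset.mul_sum]
  rw [key]
  split_ifs with hνμ
  · subst hνμ
    rw [AnuHahn_eq σ hν, sq]
  · rw [mul_zero]
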